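/- arXiv:1907.11915 — 2 statements merged into one kernel-verified Lean document; each statement's English description precedes it below -/
import Mathlib

section
/- Suppose exactly one buyer has a (general normalized monotone) submodular valuation and all other buyers have additive valuations, and suppose for every item i ∈ N and every j ∈ {2,…,m}: v_{π_i(j),i} − c_i < (m/(m−j+1)) · (v_{π_i(1),i} − c_i), and v_{π_i(1),i} > c_i for every i ∈ N. Then for every family of demand maps D_1,…,D_m as in the model, every pure Nash equilibrium p satisfies SW(p) = ∑_{j∈M} (v_j(N) − ∑_{i∈N} c_i), and this value equals the maximum of ∑_{j∈M} (v_j(S_j) − ∑_{i∈S_j} c_i) over all families of sets (S_j)_{j∈M} with S_j ⊆ N; that is, the price of anarchy equals 1. -/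
open Finset

/-- Utility of a buyer with valuation `v` for bundle `S` at prices `p`. -/
def util {n : ℕ} (v : Finset (Fin n) → ℝ) (p : Fin n → ℝ) (S : Finset (Fin n)) : ℝ :=
  v S - ∑ i ∈ S, p i

/-- `v` is a normalized, nonnegative, monotone, submodular valuation. -/
def IsValuation {n : ℕ} (v : Finset (Fin n) → ℝ) : Prop :=
  v ∅ = 0 ∧ (∀ S, 0 ≤ v S) ∧ (∀ S T, S ⊆ T → v S ≤ v T) ∧
    ∀ (S T : Finset (Fin n)) (x : Fin n), S ⊆ T → x ∉ T →
      v (insert x T) - v T ≤ v (insert x S) - v S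

/-- `v` is additive. -/
def IsAdditive {n : ℕ} (v : Finset (Fin n) → ℝ) : Prop :=
  ∀ S, v S = ∑ i ∈ S, v {i}

/-- `D` is a demand map for valuation `v`: at every price vector it selects a
utility-maximizing bundle of maximum cardinality among maximizers. -/
def IsDemandMap {n : ℕ} (v : Finset (Fin n) → ℝ)
    (D : (Fin n → ℝ) → Finset (Fin n)) : Prop :=
  ∀ p, (∀ S, util v p S ≤ util v p (D p)) ∧
    ∀ S, util v p S = util v p (D p) → S.card ≤ (D p).card

/-- Profit of seller `i`: number of buyers purchasing item `i` times `p i - c i`. -/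
def profit {n m : ℕ} (D : Fin m → (Fin n → ℝ) → Finset (Fin n)) (c : Fin n → ℝ)
    (p : Fin n → ℝ) (i : Fin n) : ℝ :=
  ((Finset.univ.filter fun j : Fin m => i ∈ D j p).card : ℝ) * (p i - c i)

/-- Pure Nash equilibrium of the sellers' pricing game (prices are nonnegative
and no seller can strictly increase profit by a unilateral price change). -/
def IsPNE {n m : ℕ} (D : Fin m → (Fin n → ℝ) → Finset (Fin n)) (c : Fin n → ℝ)
    (p : Fin n → ℝ) : Prop :=
  (∀ i, 0 ≤ p i) ∧
    ∀ (i : Fin n) (q : ℝ), 0 ≤ q →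
      profit D c (Function.update p i q) i ≤ profit D c p i

/-- `ε`-Nash equilibrium: no seller gains more than `ε` by deviating. -/
def IsEpsNE {n m : ℕ} (D : Fin m → (Fin n → ℝ) → Finset (Fin n)) (c : Fin n → ℝ)
    (ε : ℝ) (p : Fin n → ℝ) : Prop :=
  (∀ i, 0 ≤ p i) ∧
    ∀ (i : Fin n) (q : ℝ), 0 ≤ q →
      profit D c (Function.update p i q) i ≤ profit D c p i + ε

/-- Market clearing: every buyer purchases every item. -/
def MarketClearing {n m : ℕ} (D : Fin m → (Fin n → ℝ) → Finset (Fin n))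
    (p : Fin n → ℝ) : Prop :=
  ∀ j : Fin m, D j p = Finset.univ

/-- `vmarg v j i = v_j(N) - v_j(N \ {i})`. -/
def vmarg {n m : ℕ} (v : Fin m → Finset (Fin n) → ℝ) (j : Fin m) (i : Fin n) : ℝ :=
  v j Finset.univ - v j (Finset.univ.erase i)

/-- Social welfare of the allocation induced by prices `p`. -/
def SW {n m : ℕ} (v : Fin m → Finset (Fin n) → ℝ)
    (D : Fin m → (Fin n → ℝ) → Finset (Fin n)) (c : Fin n → ℝ)
    (p : Fin n → ℝ) : ℝ :=
  ∑ j : Fin m, (v j (D j p) - ∑ i ∈ D j p, c i)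

/-- An item priced at most its marginal value to the full bundle is always demanded. -/
theorem IsDemandMap.mem_of_le {n : ℕ} {v : Finset (Fin n) → ℝ}
    {D : (Fin n → ℝ) → Finset (Fin n)} (hD : IsDemandMap v D) (hv : IsValuation v)
    {p : Fin n → ℝ} {i : Fin n} (h : p i ≤ v univ - v (univ.erase i)) : i ∈ D p := by
  by_contra hi
  have hsub := hv.2.2.2 (D p) (univ.erase i) i
    (fun x hx => mem_erase.2 ⟨fun e => hi (e ▸ hx), mem_univ x⟩) (notMem_erase i univ)
  rw [insert_erase (mem_univ i)] at hsub
  have hle := (hD p).1 (insert i (D p))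
  have hutil : util v p (D p) ≤ util v p (insert i (D p)) := by
    unfold util
    rw [sum_insert hi]
    linarith
  have hcard := (hD p).2 _ (le_antisymm hle hutil)
  rw [card_insert_of_notMem hi] at hcard
  omega

/-- The price of a demanded item is at most its marginal value to the demanded bundle. -/
theorem IsDemandMap.price_le {n : ℕ} {v : Finset (Fin n) → ℝ}
    {D : (Fin n → ℝ) → Finset (Fin n)} (hD : IsDemandMap v D)
    {p : Fin n → ℝ} {i : Fin n} (hi : i ∈ D p) : p i ≤ v (D p) - v ((D p).erase i) := by
  have h := (hD p).1 ((D p).erase i)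
  have hs := add_sum_erase (D p) p hi
  unfold util at h
  linarith

theorem IsAdditive.sub_erase {n : ℕ} {v : Finset (Fin n) → ℝ} (hv : IsAdditive v)
    {S : Finset (Fin n)} {i : Fin n} (hi : i ∈ S) : v S - v (S.erase i) = v {i} := by
  rw [hv S, hv (S.erase i), ← add_sum_erase S (fun i => v {i}) hi]
  ring

/-- If every item costs at most its marginal value to the full bundle, then the full bundle
maximizes utility. -/
theorem IsDemandMap.util_le_univ {n : ℕ} {v : Finset (Fin n) → ℝ}
    {D : (Fin n → ℝ) → Finset (Fin n)} (hD : IsDemandMap v D) (hv : IsValuation v)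
    {p : Fin n → ℝ} (h : ∀ i, p i ≤ v univ - v (univ.erase i)) (S : Finset (Fin n)) :
    util v p S ≤ util v p univ := by
  have hu : D p = univ := eq_univ_iff_forall.2 fun i => hD.mem_of_le hv (h i)
  simpa only [hu] using (hD p).1 S

/-- A nonempty set of `k` elements contains one of the `m - k + 1` first elements of any
enumeration. -/
theorem exists_mem_symm_le {m : ℕ} (σ : Equiv.Perm (Fin m)) {B : Finset (Fin m)}
    (hB : B.Nonempty) : ∃ j ∈ B, (σ.symm j).val ≤ m - B.card := by
  by_contra! hcon
  have hsub : (B.map σ.symm.toEmbedding).map Fin.valEmbedding ⊆ Ioo (m - B.card) m := by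
    intro t ht
    simp only [mem_map, Equiv.coe_toEmbedding, Fin.valEmbedding_apply] at ht
    obtain ⟨_, ⟨j, hj, rfl⟩, rfl⟩ := ht
    exact mem_Ioo.2 ⟨hcon j hj, (σ.symm j).isLt⟩
  have hcard := card_le_card hsub
  rw [card_map, card_map, Nat.card_Ioo] at hcard
  have hpos := hB.card_pos
  have hle : B.card ≤ m := by simpa using card_le_univ B
  omega

/-- A price exceeding the smallest value `w (σ 0)` and accepted by a proper subset of buyers,
each valuing the item at least at that price, yields less than selling to everyone at
`w (σ 0)`. -/
theorem card_mul_lt_of_forall_le {m : ℕ} (hm : 0 < m) {w : Fin m → ℝ} {c q : ℝ}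
    {σ : Equiv.Perm (Fin m)} (hσ : ∀ j k, j ≤ k → w (σ j) ≤ w (σ k))
    (hcond : ∀ j : Fin m, 1 ≤ j.val →
      w (σ j) - c < (m : ℝ) / ((m : ℝ) - (j.val : ℝ)) * (w (σ ⟨0, hm⟩) - c))
    (hc : c < w (σ ⟨0, hm⟩)) {B : Finset (Fin m)} (hB : B.card < m) (hq : ∀ j ∈ B, q ≤ w j) :
    (B.card : ℝ) * (q - c) < m * (w (σ ⟨0, hm⟩) - c) := by
  have hm' : (0 : ℝ) < m := by exact_mod_cast hm
  rcases B.eq_empty_or_nonempty with rfl | hne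
  · simpa using mul_pos hm' (sub_pos.2 hc)
  obtain ⟨j, hj, hjle⟩ := exists_mem_symm_le σ hne
  have hpos := hne.card_pos
  have hk : (0 : ℝ) < B.card := by exact_mod_cast hpos
  have hmono := hσ (σ.symm j) ⟨m - B.card, by omega⟩ hjle
  rw [Equiv.apply_symm_apply] at hmono
  have hlt := hcond ⟨m - B.card, by omega⟩ (Nat.le_sub_of_add_le (by omega))
  simp only [Nat.cast_sub hB.le, sub_sub_cancel] at hlt
  calc (B.card : ℝ) * (q - c)
      < B.card * ((m : ℝ) / B.card * (w (σ ⟨0, hm⟩) - c)) :=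
        mul_lt_mul_of_pos_left (by linarith [hq j hj]) hk
    _ = m * (w (σ ⟨0, hm⟩) - c) := by field_simp

/-- under the hypotheses of Statement 7, every pure Nash
equilibrium `p` has social welfare `∑_j (v_j(N) - ∑_i c_i)`, which is the
maximum welfare over all allocations `(S_j)`; hence the price of anarchy
is 1. -/
theorem priceOfAnarchy_one_one_submodular_rest_additive {n m : ℕ} (hm : 0 < m)
    (v : Fin m → Finset (Fin n) → ℝ) (c : Fin n → ℝ)
    (hv : ∀ j, IsValuation (v j)) (hc : ∀ i, 0 ≤ c i)
    (j₀ : Fin m) (hadd : ∀ j, j ≠ j₀ → IsAdditive (v j))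
    (π : Fin n → Equiv.Perm (Fin m))
    (hπ : ∀ (i : Fin n) (j k : Fin m), j ≤ k → vmarg v (π i j) i ≤ vmarg v (π i k) i)
    (hcond : ∀ (i : Fin n) (j : Fin m), 1 ≤ j.val →
      vmarg v (π i j) i - c i <
        (m : ℝ) / ((m : ℝ) - (j.val : ℝ)) * (vmarg v (π i ⟨0, hm⟩) i - c i))
    (hci : ∀ i : Fin n, c i < vmarg v (π i ⟨0, hm⟩) i)
    (D : Fin m → (Fin n → ℝ) → Finset (Fin n))
    (hD : ∀ j, IsDemandMap (v j) (D j)) :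
    ∀ p, IsPNE D c p →
      SW v D c p = ∑ j : Fin m, (v j Finset.univ - ∑ i : Fin n, c i) ∧
      ∀ S : Fin m → Finset (Fin n),
        ∑ j : Fin m, (v j (S j) - ∑ i ∈ S j, c i) ≤
          ∑ j : Fin m, (v j Finset.univ - ∑ i : Fin n, c i) := by
  intro p hp
  have hmin : ∀ i j, vmarg v (π i ⟨0, hm⟩) i ≤ vmarg v j i := fun i j => by
    simpa using hπ i ⟨0, hm⟩ ((π i).symm j) (Nat.zero_le _)
  have hbound : ∀ i, (m : ℝ) * (vmarg v (π i ⟨0, hm⟩) i - c i) ≤ profit D c p i := by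
    intro i
    have h := hp.2 i (vmarg v (π i ⟨0, hm⟩) i) ((hc i).trans (hci i).le)
    have hall : ∀ j, i ∈ D j (Function.update p i (vmarg v (π i ⟨0, hm⟩) i)) := fun j =>
      (hD j).mem_of_le (hv j) (by rw [Function.update_self]; exact hmin i j)
    simpa [profit, hall] using h
  have hsell : ∀ i, (∀ j, i ∈ D j p → p i ≤ vmarg v j i) → ∀ j, i ∈ D j p := by
    intro i hle
    by_contra! hex
    obtain ⟨j, hj⟩ := hex
    have hcard : (univ.filter fun j : Fin m => i ∈ D j p).card < m := by
      simpa using card_lt_univ_of_notMem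
        (s := univ.filter fun j : Fin m => i ∈ D j p) (x := j) (by simpa using hj)
    exact absurd (hbound i) (not_le.2 (card_mul_lt_of_forall_le hm (w := fun j => vmarg v j i)
      (hπ i) (hcond i) (hci i) hcard fun j hj => hle j (mem_filter.1 hj).2))
  have hprice : ∀ j, j ≠ j₀ → ∀ i, i ∈ D j p → p i ≤ vmarg v j i := by
    intro j hj i hi
    have h := (hD j).price_le hi
    rwa [(hadd j hj).sub_erase hi, ← (hadd j hj).sub_erase (mem_univ i)] at h
  have hj₀ : D j₀ p = univ := by
    refine eq_univ_iff_forall.2 fun i => ?_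
    by_contra hi
    exact hi (hsell i (fun j hj => hprice j (fun e => hi (e ▸ hj)) i hj) j₀)
  have hclear : MarketClearing D p := fun j => eq_univ_iff_forall.2 fun i =>
    hsell i (fun k hk => by
      by_cases hkj : k = j₀
      · subst hkj
        have h := (hD k).price_le hk
        rwa [hj₀] at h
      · exact hprice k hkj i hk) j
  refine ⟨sum_congr rfl fun j _ => by rw [hclear j], fun S => sum_le_sum fun j _ => ?_⟩
  exact (hD j).util_le_univ (hv j) (fun i => (hci i).le.trans (hmin i j)) (S j)
end

section
/- Consider the instance with n = 2 sellers, m = 2 buyers, one copy per seller, zero production costs, buyer 1 additive with v_1({1}) = v_1({2}) = 16 (so v_1({1,2}) = 32), buyer 2 submodular with v_2({1}) = v_2({2}) = 30 and v_2({1,2}) = 45, and buyer 1 arriving before buyer 2. Then for every ε with 0 ≤ ε < 7 and every demand maps consistent with the model, no price vector is an ε-Nash equilibrium; in particular no pure Nash equilibrium exists. -/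
open Finset

/-- A sequential demand map: given prices and a set `A` of still-available items,
it selects a subset of `A` maximizing utility, of maximum cardinality among
such maximizers. -/
def IsSeqDemandMap {n : ℕ} (v : Finset (Fin n) → ℝ)
    (D : (Fin n → ℝ) → Finset (Fin n) → Finset (Fin n)) : Prop :=
  ∀ p A, D p A ⊆ A ∧ (∀ S ⊆ A, util v p S ≤ util v p (D p A)) ∧
    ∀ S ⊆ A, util v p S = util v p (D p A) → S.card ≤ (D p A).card

/-- `avail D p j` is the set of items still unsold after buyers `1, …, j` (i.e.
the first `j` buyers, 0-indexed `0, …, j-1`) have purchased in order. -/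
def avail {n m : ℕ} (D : Fin m → (Fin n → ℝ) → Finset (Fin n) → Finset (Fin n))
    (p : Fin n → ℝ) : ℕ → Finset (Fin n)
  | 0 => Finset.univ
  | j + 1 => if h : j < m then avail D p j \ D ⟨j, h⟩ p (avail D p j) else avail D p j

/-- Profit of seller `i`: `p i - c i` if item `i` is sold to some buyer, else `0`. -/
def sprofit {n m : ℕ} (D : Fin m → (Fin n → ℝ) → Finset (Fin n) → Finset (Fin n))
    (c : Fin n → ℝ) (p : Fin n → ℝ) (i : Fin n) : ℝ :=
  if i ∈ avail D p m then 0 else p i - c i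

/-- `ε`-Nash equilibrium of the sequential pricing game (taking `ε = 0` gives a
pure Nash equilibrium). -/
def SeqEpsNE {n m : ℕ} (D : Fin m → (Fin n → ℝ) → Finset (Fin n) → Finset (Fin n))
    (c : Fin n → ℝ) (ε : ℝ) (p : Fin n → ℝ) : Prop :=
  (∀ i, 0 ≤ p i) ∧
    ∀ (i : Fin n) (q : ℝ), 0 ≤ q →
      sprofit D c (Function.update p i q) i ≤ sprofit D c p i + ε

theorem IsSeqDemandMap.mem_iff_of_isAdditive {n : ℕ} {v : Finset (Fin n) → ℝ}
    {D : (Fin n → ℝ) → Finset (Fin n) → Finset (Fin n)} (hD : IsSeqDemandMap v D)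
    (hv : IsAdditive v) {p : Fin n → ℝ} {A : Finset (Fin n)} {i : Fin n} (hi : i ∈ A) :
    i ∈ D p A ↔ p i ≤ v {i} := by
  obtain ⟨hsub, hmax, hcard⟩ := hD p A
  have hutil : ∀ S, util v p S = ∑ k ∈ S, (v {k} - p k) := fun S => by
    rw [util, hv S, Finset.sum_sub_distrib]
  constructor
  · intro hmem
    have h := hmax _ ((Finset.erase_subset i _).trans hsub)
    rw [hutil, hutil, ← Finset.add_sum_erase _ _ hmem] at h
    linarith
  · intro hle
    by_contra hmem
    have hins : insert i (D p A) ⊆ A := Finset.insert_subset hi hsub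
    have hsum : util v p (insert i (D p A)) = (v {i} - p i) + util v p (D p A) := by
      rw [hutil, hutil, Finset.sum_insert hmem]
    have h := hcard _ hins (le_antisymm (hmax _ hins) (by linarith))
    rw [Finset.card_insert_of_notMem hmem] at h
    omega

theorem IsSeqDemandMap.mem_singleton_of_le {n : ℕ} {v : Finset (Fin n) → ℝ}
    {D : (Fin n → ℝ) → Finset (Fin n) → Finset (Fin n)} (hD : IsSeqDemandMap v D)
    (hv : v ∅ = 0) {p : Fin n → ℝ} {i : Fin n} (hi : p i ≤ v {i}) : i ∈ D p {i} := by
  obtain ⟨hsub, hmax, hcard⟩ := hD p {i}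
  rcases Finset.subset_singleton_iff.1 hsub with h | h
  · have hle := hmax _ subset_rfl
    have hc := hcard _ subset_rfl
    rw [h] at hle hc
    simp only [util, hv, Finset.sum_singleton, Finset.sum_empty] at hle hc
    have := hc (by linarith)
    simp at this
  · simp [h]

theorem mem_avail_two_iff {n : ℕ} (D : Fin 2 → (Fin n → ℝ) → Finset (Fin n) → Finset (Fin n))
    (p : Fin n → ℝ) (i : Fin n) :
    i ∈ avail D p 2 ↔ i ∉ D 0 p univ ∧ i ∉ D 1 p (univ \ D 0 p univ) := by
  simp [avail]

theorem finset_fin_two_cases {i j : Fin 2} (hij : i ≠ j) (S : Finset (Fin 2)) :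
    S = ∅ ∨ S = {i} ∨ S = {j} ∨ S = {i, j} := by
  revert i j S
  decide

theorem univ_eq_pair_of_ne {i j : Fin 2} (hij : i ≠ j) : (univ : Finset (Fin 2)) = {i, j} := by
  revert i j
  decide

/-- When both items are available, a buyer who strictly prefers `{i}` to every bundle
avoiding `i` buys item `i`. -/
theorem IsSeqDemandMap.mem_univ_of_lt {v : Finset (Fin 2) → ℝ}
    {D : (Fin 2 → ℝ) → Finset (Fin 2) → Finset (Fin 2)} (hD : IsSeqDemandMap v D)
    {p : Fin 2 → ℝ} {i j : Fin 2} (hij : i ≠ j) (h0 : v ∅ = 0) (hi : p i ≤ v {i})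
    (hj : v {j} - p j < v {i} - p i) : i ∈ D p univ := by
  obtain ⟨-, hmax, hcard⟩ := hD p univ
  have hle := hmax {i} (Finset.subset_univ _)
  have hc := hcard {i} (Finset.subset_univ _)
  rcases finset_fin_two_cases hij (D p univ) with h | h | h | h <;> rw [h] at hle hc ⊢ <;>
    simp only [util, h0, Finset.sum_singleton, Finset.sum_empty] at hle hc
  · have := hc (by linarith)
    simp at this
  · simp
  · linarith
  · simp

theorem IsSeqDemandMap.ne_univ_of_lt {v : Finset (Fin 2) → ℝ}
    {D : (Fin 2 → ℝ) → Finset (Fin 2) → Finset (Fin 2)} (hD : IsSeqDemandMap v D)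
    {p : Fin 2 → ℝ} (h : v {0, 1} - v {0} < p 1) : D p univ ≠ univ := by
  intro heq
  have hle := (hD p univ).2.1 {0} (Finset.subset_univ _)
  rw [heq, univ_eq_pair_of_ne (show (0 : Fin 2) ≠ 1 by decide)] at hle
  simp only [util, Finset.sum_singleton, Finset.sum_pair (show (0 : Fin 2) ≠ 1 by decide)] at hle
  linarith

/-- Example 4.1: single-copy sequential game, two sellers, zero
costs; buyer 1 (arriving first) additive with values 16, 16 and buyer 2
submodular with `v_2({1}) = v_2({2}) = 30`, `v_2({1,2}) = 45`. For every
`0 ≤ ε < 7` and all demand maps consistent with the model, no price vector is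
an `ε`-Nash equilibrium; in particular no pure Nash equilibrium exists. -/
theorem seq_no_epsNE_example {v : Fin 2 → Finset (Fin 2) → ℝ}
    (hv10 : v 0 ∅ = 0) (hv11 : v 0 {0} = 16) (hv12 : v 0 {1} = 16)
    (hv13 : v 0 {0, 1} = 32)
    (hv20 : v 1 ∅ = 0) (hv21 : v 1 {0} = 30) (hv22 : v 1 {1} = 30)
    (hv23 : v 1 {0, 1} = 45)
    (D : Fin 2 → (Fin 2 → ℝ) → Finset (Fin 2) → Finset (Fin 2))
    (hD : ∀ j, IsSeqDemandMap (v j) (D j))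
    (ε : ℝ) (hε0 : 0 ≤ ε) (hε : ε < 7) :
    ∀ p : Fin 2 → ℝ, ¬ SeqEpsNE D (fun _ => 0) ε p := by
  have h01 : (0 : Fin 2) ≠ 1 := by decide
  have hv1 : ∀ i, v 0 {i} = 16 := by
    intro i; fin_cases i <;> assumption
  have hv2 : ∀ i, v 1 {i} = 30 := by
    intro i; fin_cases i <;> assumption
  have hadd : IsAdditive (v 0) := by
    intro S
    rcases finset_fin_two_cases h01 S with rfl | rfl | rfl | rfl
    · simpa using hv10
    · simp
    · simp
    · rw [Finset.sum_pair h01, hv13, hv11, hv12]; norm_num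
  have hfirst : ∀ p i, i ∈ D 0 p univ ↔ p i ≤ 16 := fun p i => by
    rw [(hD 0).mem_iff_of_isAdditive hadd (Finset.mem_univ i), hv1]
  have hsold : ∀ p i, i ∉ avail D p 2 → sprofit D (fun _ => 0) p i = p i := fun p i h => by
    simp [sprofit, h]
  have hlow : ∀ p i, p i ≤ 16 → sprofit D (fun _ => 0) p i = p i := fun p i h => by
    refine hsold p i fun hmem => ?_
    exact ((mem_avail_two_iff D p i).1 hmem).1 ((hfirst p i).2 h)
  have hmid : ∀ p i j, i ≠ j → 16 < p i → p i ≤ 30 → p j ≤ 16 →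
      sprofit D (fun _ => 0) p i = p i := fun p i j hij h16 h30 hj => by
    refine hsold p i fun hmem => ((mem_avail_two_iff D p i).1 hmem).2 ?_
    have hi : i ∉ D 0 p univ := by rw [hfirst]; linarith
    have hj : j ∈ D 0 p univ := (hfirst p j).2 hj
    have hset : univ \ D 0 p univ = {i} := by
      rw [univ_eq_pair_of_ne hij] at *
      ext k
      simp only [Finset.mem_sdiff, Finset.mem_insert, Finset.mem_singleton]
      grind
    rw [hset]
    exact (hD 1).mem_singleton_of_le hv20 (by rw [hv2]; exact h30)
  have hrest : ∀ p, (∀ i, 16 < p i) → univ \ D 0 p univ = univ := fun p hp => by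
    ext k
    simp [hfirst, hp k]
  have hunder : ∀ p i j, i ≠ j → 16 < p i → p i ≤ 30 → p i < p j →
      sprofit D (fun _ => 0) p i = p i := fun p i j hij h16 h30 hlt => by
    refine hsold p i fun hmem => ((mem_avail_two_iff D p i).1 hmem).2 ?_
    rw [hrest p fun k => ?_]
    · exact (hD 1).mem_univ_of_lt hij hv20 (by rw [hv2]; exact h30)
        (by rw [hv2, hv2]; linarith)
    · have hk : k ∈ ({i, j} : Finset (Fin 2)) := univ_eq_pair_of_ne hij ▸ Finset.mem_univ k
      rcases Finset.mem_insert.1 hk with rfl | hk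
      · exact h16
      · rw [Finset.mem_singleton.1 hk]; linarith
  rintro p ⟨hp, hNE⟩
  have hmixed : ∀ i j, i ≠ j → p i ≤ 16 → 16 < p j → False := fun i j hij hi hj => by
    have hb := hNE j 30 (by norm_num)
    rw [hmid (Function.update p j 30) j i hij.symm (by simp; norm_num) (by simp)
      (by simpa [hij] using hi), Function.update_self] at hb
    have hpj : sprofit D (fun _ => 0) p j ≤ p j := by
      unfold sprofit
      split_ifs
      · exact hp j
      · simp
    have ha := hNE i 23 (by norm_num)
    rw [hunder (Function.update p i 23) i j hij (by simp; norm_num) (by simp; norm_num)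
      (by simp [hij.symm]; linarith), Function.update_self, hlow p i hi] at ha
    linarith
  rcases le_or_gt (p 0) 16 with h0 | h0 <;> rcases le_or_gt (p 1) 16 with h1 | h1
  · have h := hNE 0 30 (by norm_num)
    rw [hmid (Function.update p 0 30) 0 1 h01 (by simp; norm_num) (by simp)
      (by simpa using h1), Function.update_self, hlow p 0 h0] at h
    linarith
  · exact hmixed 0 1 h01 h0 h1
  · exact hmixed 1 0 h01.symm h1 h0
  · have hall : ∀ i, 16 < p i := by
      intro i; fin_cases i <;> assumption
    have hne : D 1 p univ ≠ univ := (hD 1).ne_univ_of_lt (by rw [hv23, hv21]; linarith)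
    obtain ⟨i, hi⟩ : ∃ i, i ∉ D 1 p univ := by
      by_contra! hcon
      exact hne (Finset.eq_univ_iff_forall.2 hcon)
    have hzero : sprofit D (fun _ => 0) p i = 0 := by
      have : i ∈ avail D p 2 := by
        rw [mem_avail_two_iff, hrest p hall, hfirst]
        exact ⟨not_le.2 (hall i), hi⟩
      simp [sprofit, this]
    have h := hNE i 16 (by norm_num)
    rw [hlow _ i (by simp), Function.update_self, hzero] at h
    linarith
end
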